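/- arXiv:2509.12538 — 6 statements merged into one kernel-verified Lean document; each statement's English description precedes it below -/
import Mathlib

section
/- First-stage identity for the nobody-treated indicator under an own-instrument switch. Assume Assumptions IV, SM and IRR hold. Then Δ^{10}_{00}E[D_{i(i)}^∨] = −P(D_i(1,0) > D_i(0,0), D_{(i)}(0,0) = 0); that is, the decrease in the probability that neither i nor any peer is treated when i's instrument is switched from 0 to 1 (all peers' instruments fixed at 0) equals the probability that i is induced into treatment by its own instrument while no peer would be treated at instrument pattern (0,0). -/
open MeasureTheory ProbabilityTheory

noncomputable section

/-- Real value of a Boolean indicator. -/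
def b2r (b : Bool) : ℝ := if b then 1 else 0

variable {Ω : Type*} {m : ℕ}

/-- Conditional expectation of `X` given the event `A`, i.e. `E[X·1_A]/P(A)`. -/
def cexp [MeasurableSpace Ω] (P : Measure Ω) (X : Ω → ℝ) (A : Set Ω) : ℝ :=
  (∫ ω in A, X ω ∂P) / (P A).toReal

/-- The event `{Z_i = z, Z_{(i)} = z'}` (all peer instruments equal `z'`). -/
def ZevM (Zi : Ω → Bool) (Zp : Ω → Fin m → Bool) (z z' : Bool) : Set Ω :=
  {ω | Zi ω = z ∧ ∀ j, Zp ω j = z'}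

/-- `Δ^{zz'}_{ww'} E[X]`, where `X z z'` is the observed quantity under the
instrument pattern `(z, z')`. -/
def dEM [MeasurableSpace Ω] (P : Measure Ω) (Zi : Ω → Bool) (Zp : Ω → Fin m → Bool)
    (X : Bool → Bool → Ω → ℝ) (z z' w w' : Bool) : ℝ :=
  cexp P (X z z') (ZevM Zi Zp z z') - cexp P (X w w') (ZevM Zi Zp w w')

/-- The indicator of the event that nobody is treated is the product of the non-treatment
indicators. -/
lemma nobody_treated_eq_indicator (d : Ω → Bool) (dp : Ω → Fin m → Bool) :
    (fun ω => (1 - b2r (d ω)) * ∏ j, (1 - b2r (dp ω j))) =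
      Set.indicator {ω | d ω = false ∧ ∀ j, dp ω j = false} 1 := by
  funext ω
  by_cases h : d ω = false ∧ ∀ j, dp ω j = false
  · rw [Set.indicator_of_mem (by exact h)]
    simp [b2r, h.1, h.2]
  · rw [Set.indicator_of_notMem (by exact h)]
    rw [not_and_or, not_forall] at h
    rcases h with h | ⟨j, h⟩
    · simp [b2r, h]
    · rw [Finset.prod_eq_zero (Finset.mem_univ j) (by simp [b2r, h]), mul_zero]

lemma measurableSet_nobody_treated [MeasurableSpace Ω] {d : Ω → Bool} {dp : Ω → Fin m → Bool}
    (hd : Measurable d) (hdp : Measurable dp) :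
    MeasurableSet {ω | d ω = false ∧ ∀ j, dp ω j = false} := by
  have hprod : Measurable fun ω => (d ω, dp ω) := hd.prodMk hdp
  exact hprod (Set.toFinite {q | q.1 = false ∧ ∀ j, q.2 j = false}).measurableSet

/-- Conditioning the indicator of `S` on an independent event of positive probability gives the
unconditional probability of `S`. -/
lemma cexp_indicator_of_measure_inter_eq_mul [MeasurableSpace Ω] (P : Measure Ω)
    [IsProbabilityMeasure P] {A S : Set Ω} (hS : MeasurableSet S) (hA : 0 < P A)
    (h : P (A ∩ S) = P A * P S) :
    cexp P (S.indicator 1) A = (P S).toReal := by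
  have hA' : (P A).toReal ≠ 0 := (ENNReal.toReal_pos hA.ne' (measure_ne_top P A)).ne'
  rw [cexp, integral_indicator_one hS, measureReal_def, Measure.restrict_apply hS,
    Set.inter_comm, h, ENNReal.toReal_mul, mul_div_cancel_left₀ _ hA']

/-- First-stage identity for the nobody-treated indicator under an own-instrument switch. -/
theorem first_stage_nobody_treated_own_switch
    [MeasurableSpace Ω] (P : Measure Ω) [IsProbabilityMeasure P]
    (m : ℕ) (hm : 1 ≤ m)
    (Zi : Ω → Bool) (Zp : Ω → Fin m → Bool)
    (Di : Bool → Bool → Ω → Bool) (Dp : Bool → Bool → Ω → Fin m → Bool)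
    (Y : Bool → (Fin m → Bool) → Ω → ℝ)
    (hZi : Measurable Zi) (hZp : Measurable Zp)
    (hDi : ∀ z z', Measurable (Di z z')) (hDp : ∀ z z', Measurable (Dp z z'))
    (hYm : ∀ d dp, Measurable (Y d dp)) (hYint : ∀ d dp, Integrable (Y d dp) P)
    (hZpos : ∀ z z', 0 < P (ZevM Zi Zp z z'))
    -- Assumption IV: independence and own-instrument monotonicity
    (hIndep : IndepFun (fun ω => (Zi ω, Zp ω))
      (fun ω => (fun z z' => Di z z' ω, fun z z' => Dp z z' ω,
        fun d dp => Y d dp ω)) P)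
    (hIV : ∀ᵐ ω ∂P, (∀ z, Di false z ω ≤ Di true z ω) ∧
      ∀ zi j, Dp zi false ω j ≤ Dp zi true ω j)
    -- Assumption SM: monotonicity in the spillovers
    (hSM : ∀ᵐ ω ∂P, (∀ zi, Di zi false ω ≤ Di zi true ω) ∧
      ∀ z j, Dp false z ω j ≤ Dp true z ω j)
    -- Assumption IRR: irrelevance
    (hIRR : ∀ᵐ ω ∂P, (∀ z, Di true z ω = Di false z ω → Dp true z ω = Dp false z ω) ∧
      ∀ zi, Dp zi true ω = Dp zi false ω → Di zi true ω = Di zi false ω)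
    :
    dEM P Zi Zp (fun z z' ω => (1 - b2r (Di z z' ω)) *
        ∏ j, (1 - b2r (Dp z z' ω j))) true false false false =
      -(P {ω | Di true false ω = true ∧ Di false false ω = false ∧
        ∀ j, Dp false false ω j = false}).toReal := by
  let S : Bool → Bool → Set Ω := fun z z' => {ω | Di z z' ω = false ∧ ∀ j, Dp z z' ω j = false}
  have hS (z z' : Bool) : MeasurableSet (S z z') :=
    measurableSet_nobody_treated (hDi z z') (hDp z z')
  have hmean (z z' : Bool) : cexp P (fun ω => (1 - b2r (Di z z' ω)) *
      ∏ j, (1 - b2r (Dp z z' ω j))) (ZevM Zi Zp z z') = (P (S z z')).toReal := by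
    rw [nobody_treated_eq_indicator]
    refine cexp_indicator_of_measure_inter_eq_mul P (hS z z') (hZpos z z') ?_
    refine hIndep.measure_inter_preimage_eq_mul {p | p.1 = z ∧ ∀ j, p.2 j = z'}
      {q | q.1 z z' = false ∧ ∀ j, q.2.1 z z' j = false} ?_ ?_
    · exact (Set.toFinite _).measurableSet
    · exact measurableSet_nobody_treated (by fun_prop) (by fun_prop)
  have hsub : S true false ≤ᵐ[P] S false false := by
    filter_upwards [hIV, hIRR] with ω hmono hirr
    rintro ⟨hd, hdp⟩
    have hd₀ : Di false false ω = false := by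
      have := hmono.1 false
      rw [hd] at this
      exact le_bot_iff.mp this
    refine ⟨hd₀, fun j => ?_⟩
    rw [← hirr.1 false (hd.trans hd₀.symm)]
    exact hdp j
  have hdiff : {ω | Di true false ω = true ∧ Di false false ω = false ∧
      ∀ j, Dp false false ω j = false} =ᵐ[P] (S false false \ S true false : Set Ω) := by
    filter_upwards [hIRR] with ω hirr
    refine propext ⟨fun h => ⟨h.2, fun h' => ?_⟩, fun h => ⟨?_, h.1⟩⟩
    · exact Bool.false_ne_true (h'.1.symm.trans h.1)
    · by_contra hne
      have hd : Di true false ω = false := Bool.eq_false_of_not_eq_true hne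
      refine h.2 ⟨hd, fun j => ?_⟩
      rw [hirr.1 false (hd.trans h.1.1.symm)]
      exact h.1.2 j
  have hadd := measureReal_inter_add_sdiff (μ := P) (s := S false false) (hS true false)
  have hinter : (S false false ∩ S true false : Set Ω) =ᵐ[P] S true false := by
    filter_upwards [hsub] with ω h
    exact propext ⟨fun h' => h'.2, fun h' => ⟨h h', h'⟩⟩
  rw [measureReal_congr hinter] at hadd
  rw [dEM, hmean, hmean, measure_congr hdiff]
  simp only [measureReal_def] at hadd
  linarith

end
end

section
/- First-stage identity isolating always-takers with instrument-responsive peers. Assume Assumptions IV, SM and IRR hold. Then Δ^{01}_{00}E[D_i D_{(i)}^∨] = −P(D_i(0,1) = D_i(0,0) = 1, D_{(i)}(0,1) ≠ D_{(i)}(0,0) = 0). -/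
open MeasureTheory ProbabilityTheory

noncomputable section

variable {Ω : Type*} {m : ℕ}

lemma setIntegral_indicator_one_of_indepSet [MeasurableSpace Ω] {P : Measure Ω} {A B : Set Ω}
    (hB : MeasurableSet B) (h : P (A ∩ B) = P A * P B) :
    ∫ ω in A, B.indicator (fun _ => (1 : ℝ)) ω ∂P = (P A).toReal * (P B).toReal := by
  rw [integral_indicator hB, setIntegral_const, smul_eq_mul, mul_one, measureReal_def,
    Measure.restrict_apply hB, Set.inter_comm, h, ENNReal.toReal_mul]

lemma cexp_indicator_one_of_indepSet [MeasurableSpace Ω] {P : Measure Ω} [IsFiniteMeasure P]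
    {A B : Set Ω} (hA : 0 < P A) (hB : MeasurableSet B) (h : P (A ∩ B) = P A * P B) :
    cexp P (B.indicator fun _ => (1 : ℝ)) A = (P B).toReal := by
  have hne : (P A).toReal ≠ 0 := (ENNReal.toReal_pos hA.ne' (measure_ne_top P A)).ne'
  rw [cexp, setIntegral_indicator_one_of_indepSet hB h, mul_div_cancel_left₀ _ hne]

/-- The event that the individual is treated while no peer is, under fixed potential treatments. -/
def treatedAlone (D : Ω → Bool) (Dp : Ω → Fin m → Bool) : Set Ω :=
  {ω | D ω = true ∧ ∀ j, Dp ω j = false}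

lemma measurableSet_treatedAlone [MeasurableSpace Ω] {D : Ω → Bool} {Dp : Ω → Fin m → Bool}
    (hD : Measurable D) (hDp : Measurable Dp) : MeasurableSet (treatedAlone D Dp) := by
  have hset : treatedAlone D Dp = (fun ω => (D ω, Dp ω)) ⁻¹' {p | p.1 = true ∧ ∀ j, p.2 j = false} :=
    rfl
  rw [hset]
  exact (hD.prodMk hDp) (Set.toFinite _).measurableSet

lemma b2r_mul_prod_eq_indicator (D : Ω → Bool) (Dp : Ω → Fin m → Bool) :
    (fun ω => b2r (D ω) * ∏ j, (1 - b2r (Dp ω j))) =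
      (treatedAlone D Dp).indicator fun _ => (1 : ℝ) := by
  funext ω
  by_cases h : ω ∈ treatedAlone D Dp
  · rw [Set.indicator_of_mem h]
    simp [b2r, h.1, h.2]
  · rw [Set.indicator_of_notMem h]
    by_cases hD : D ω = true
    · obtain ⟨j, hj⟩ : ∃ j, Dp ω j = true := by
        by_contra! hne
        exact h ⟨hD, fun j => by simpa using hne j⟩
      rw [Finset.prod_eq_zero (Finset.mem_univ j) (by simp [b2r, hj]), mul_zero]
    · simp [b2r, hD]

/-- First-stage identity isolating always-takers with instrument-responsive peers. -/
theorem first_stage_always_takers_responsive_peers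
    [MeasurableSpace Ω] (P : Measure Ω) [IsProbabilityMeasure P]
    (m : ℕ) (hm : 1 ≤ m)
    (Zi : Ω → Bool) (Zp : Ω → Fin m → Bool)
    (Di : Bool → Bool → Ω → Bool) (Dp : Bool → Bool → Ω → Fin m → Bool)
    (Y : Bool → (Fin m → Bool) → Ω → ℝ)
    (hZi : Measurable Zi) (hZp : Measurable Zp)
    (hDi : ∀ z z', Measurable (Di z z')) (hDp : ∀ z z', Measurable (Dp z z'))
    (hYm : ∀ d dp, Measurable (Y d dp)) (hYint : ∀ d dp, Integrable (Y d dp) P)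
    (hZpos : ∀ z z', 0 < P (ZevM Zi Zp z z'))
    -- Assumption IV: independence and own-instrument monotonicity
    (hIndep : IndepFun (fun ω => (Zi ω, Zp ω))
      (fun ω => (fun z z' => Di z z' ω, fun z z' => Dp z z' ω,
        fun d dp => Y d dp ω)) P)
    (hIV : ∀ᵐ ω ∂P, (∀ z, Di false z ω ≤ Di true z ω) ∧
      ∀ zi j, Dp zi false ω j ≤ Dp zi true ω j)
    -- Assumption SM: monotonicity in the spillovers
    (hSM : ∀ᵐ ω ∂P, (∀ zi, Di zi false ω ≤ Di zi true ω) ∧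
      ∀ z j, Dp false z ω j ≤ Dp true z ω j)
    -- Assumption IRR: irrelevance
    (hIRR : ∀ᵐ ω ∂P, (∀ z, Di true z ω = Di false z ω → Dp true z ω = Dp false z ω) ∧
      ∀ zi, Dp zi true ω = Dp zi false ω → Di zi true ω = Di zi false ω)
    :
    dEM P Zi Zp (fun z z' ω => b2r (Di z z' ω) *
        ∏ j, (1 - b2r (Dp z z' ω j))) false true false false =
      -(P {ω | Di false true ω = true ∧ Di false false ω = true ∧
        Dp false true ω ≠ Dp false false ω ∧
        ∀ j, Dp false false ω j = false}).toReal := by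
  have hmeas (z z' : Bool) : MeasurableSet (treatedAlone (Di z z') (Dp z z')) :=
    measurableSet_treatedAlone (hDi z z') (hDp z z')
  have hcexp (z z' : Bool) :
      cexp P (fun ω => b2r (Di z z' ω) * ∏ j, (1 - b2r (Dp z z' ω j))) (ZevM Zi Zp z z') =
        (P (treatedAlone (Di z z') (Dp z z'))).toReal := by
    rw [b2r_mul_prod_eq_indicator]
    refine cexp_indicator_one_of_indepSet (hZpos z z') (hmeas z z') ?_
    refine hIndep.measure_inter_preimage_eq_mul
      {p : Bool × (Fin m → Bool) | p.1 = z ∧ ∀ j, p.2 j = z'}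
      {q : (Bool → Bool → Bool) × (Bool → Bool → Fin m → Bool) ×
        (Bool → (Fin m → Bool) → ℝ) | q.1 z z' = true ∧ ∀ j, q.2.1 z z' j = false}
      (Set.toFinite _).measurableSet ?_
    refine measurableSet_treatedAlone (D := fun q : (Bool → Bool → Bool) ×
      (Bool → Bool → Fin m → Bool) × (Bool → (Fin m → Bool) → ℝ) => q.1 z z')
      (Dp := fun q => q.2.1 z z') ?_ ?_ <;> fun_prop
  have hsub : treatedAlone (Di false true) (Dp false true) ≤ᵐ[P]
      treatedAlone (Di false false) (Dp false false) := by
    filter_upwards [hIV, hIRR] with ω hiv hirr hω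
    have h0 (j : Fin m) : Dp false false ω j = false :=
      le_bot_iff.1 ((hiv.2 false j).trans_eq (hω.2 j))
    exact ⟨hirr.2 false (funext fun j => (hω.2 j).trans (h0 j).symm) ▸ hω.1, h0⟩
  have hdiff : ({ω | Di false true ω = true ∧ Di false false ω = true ∧
      Dp false true ω ≠ Dp false false ω ∧ ∀ j, Dp false false ω j = false} : Set Ω) =ᵐ[P]
      (treatedAlone (Di false false) (Dp false false) \
        treatedAlone (Di false true) (Dp false true) : Set Ω) := by
    filter_upwards [hSM] with ω hsm
    refine propext ⟨fun ⟨_, h00, hne, h0⟩ => ⟨⟨h00, h0⟩, fun h => hne ?_⟩, fun ⟨h, hn⟩ => ?_⟩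
    · exact funext fun j => (h.2 j).trans (h0 j).symm
    · have h01 : Di false true ω = true :=
        top_le_iff.1 (h.1.symm.trans_le (hsm.1 false))
      exact ⟨h01, h.1, fun heq => hn ⟨h01, fun j => heq ▸ h.2 j⟩, h.2⟩
  have hadd : P.real (treatedAlone (Di false false) (Dp false false) \
      treatedAlone (Di false true) (Dp false true)) +
      P.real (treatedAlone (Di false true) (Dp false true)) =
      P.real (treatedAlone (Di false false) (Dp false false)) := by
    rw [← measureReal_sdiff_add_inter (μ := P)
      (s := treatedAlone (Di false false) (Dp false false)) (hmeas false true)]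
    congr 1
    refine measureReal_congr ?_
    filter_upwards [hsub] with ω h
    exact propext ⟨fun hω => ⟨h hω, hω⟩, fun hω => hω.2⟩
  rw [dEM, hcexp, hcexp, measure_congr hdiff]
  simp only [← measureReal_def]
  linarith

end
end

section
/- First-stage identities for the all-peers-treated indicator under an own-instrument switch. Assume Assumptions IV, SM and IRR hold. Then Δ^{11}_{01}E[D_{(i)}^∧] = P(D_i(1,1) > D_i(0,1), D_{(i)}(0,1) ≠ D_{(i)}(1,1) = 1) and Δ^{11}_{01}E[D_{i(i)}^∧] = P(D_i(1,1) > D_i(0,1), D_{(i)}(1,1) = 1). -/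
open MeasureTheory ProbabilityTheory

noncomputable section

variable {Ω : Type*} {m : ℕ}

@[simp]
lemma b2r_true : b2r true = 1 := rfl

@[simp]
lemma b2r_false : b2r false = 0 := rfl

lemma prod_b2r {ι : Type*} [Fintype ι] (v : ι → Bool) [Decidable (∀ j, v j = true)] :
    ∏ j, b2r (v j) = if ∀ j, v j = true then 1 else 0 := by
  split_ifs with h
  · simp [h]
  · obtain ⟨j, hj⟩ := not_forall.mp h
    exact Finset.prod_eq_zero (Finset.mem_univ j) (by simp [Bool.eq_false_of_not_eq_true hj])

lemma cexp_preimage_eq_integral_of_indepFun {α : Type*} [MeasurableSpace Ω] [MeasurableSpace α]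
    {P : Measure Ω} [IsProbabilityMeasure P] {f : Ω → α} {g : Ω → ℝ} {s : Set α}
    (hfg : IndepFun f g P) (hf : Measurable f) (hg : AEStronglyMeasurable g P)
    (hs : MeasurableSet s) (h0 : P (f ⁻¹' s) ≠ 0) :
    cexp P g (f ⁻¹' s) = ∫ ω, g ω ∂P := by
  have hind : IndepFun (s.indicator (1 : α → ℝ) ∘ f) g P :=
    hfg.comp (measurable_one.indicator hs) measurable_id
  have hmeas : Measurable (s.indicator (1 : α → ℝ) ∘ f) :=
    (measurable_one.indicator hs).comp hf
  have hset : ∫ ω in f ⁻¹' s, g ω ∂P = P.real (f ⁻¹' s) * ∫ ω, g ω ∂P := by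
    rw [← integral_indicator (hf hs), ← integral_indicator_one (hf hs)]
    refine Eq.trans (integral_congr_ae (.of_forall fun ω => ?_))
      (hind.integral_mul_eq_mul_integral hmeas.aestronglyMeasurable hg)
    by_cases hω : f ω ∈ s <;> simp [hω]
  have hne : P.real (f ⁻¹' s) ≠ 0 := (measureReal_ne_zero_iff).2 h0
  rw [cexp, hset]
  exact mul_div_cancel_left₀ _ hne

lemma dEM_eq_measureReal [MeasurableSpace Ω] {α : Type*} [MeasurableSpace α] {P : Measure Ω}
    [IsProbabilityMeasure P] {Zi : Ω → Bool} {Zp : Ω → Fin m → Bool} {T : Ω → α}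
    {φ : Bool → Bool → α → ℝ} {S : Set Ω} {z z' w w' : Bool}
    (hZi : Measurable Zi) (hZp : Measurable Zp)
    (hZpos : ∀ z z', 0 < P (ZevM Zi Zp z z'))
    (hIndep : IndepFun (fun ω => (Zi ω, Zp ω)) T P)
    (hφ : ∀ z z', Measurable (φ z z'))
    (hint : ∀ z z', Integrable (fun ω => φ z z' (T ω)) P)
    (hS : MeasurableSet S)
    (hdiff : ∀ᵐ ω ∂P, φ z z' (T ω) - φ w w' (T ω) = S.indicator 1 ω) :
    dEM P Zi Zp (fun z z' ω => φ z z' (T ω)) z z' w w' = P.real S := by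
  have hcexp (a b : Bool) :
      cexp P (fun ω => φ a b (T ω)) (ZevM Zi Zp a b) = ∫ ω, φ a b (T ω) ∂P :=
    cexp_preimage_eq_integral_of_indepFun (f := fun ω => (Zi ω, Zp ω))
      (s := {p | p.1 = a ∧ ∀ j, p.2 j = b})
      (hIndep.comp measurable_id (hφ a b)) (hZi.prodMk hZp) (hint a b).aestronglyMeasurable
      (Set.toFinite _).measurableSet (hZpos a b).ne'
  rw [dEM, hcexp, hcexp, ← integral_sub (hint _ _) (hint _ _), integral_congr_ae hdiff,
    integral_indicator_one hS]

lemma measurable_b2r : Measurable b2r := measurable_of_finite _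

lemma norm_b2r_le_one (b : Bool) : ‖b2r b‖ ≤ 1 := by cases b <;> simp

lemma norm_prod_b2r_le_one {ι : Type*} [Fintype ι] (v : ι → Bool) : ‖∏ j, b2r (v j)‖ ≤ 1 := by
  rw [norm_prod]
  exact Finset.prod_le_one (fun _ _ => norm_nonneg _) fun _ _ => norm_b2r_le_one _

/-- First-stage identities for the all-peers-treated indicator under an own-instrument switch. -/
theorem first_stage_all_peers_treated_own_switch
    [MeasurableSpace Ω] (P : Measure Ω) [IsProbabilityMeasure P]
    (m : ℕ) (hm : 1 ≤ m)
    (Zi : Ω → Bool) (Zp : Ω → Fin m → Bool)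
    (Di : Bool → Bool → Ω → Bool) (Dp : Bool → Bool → Ω → Fin m → Bool)
    (Y : Bool → (Fin m → Bool) → Ω → ℝ)
    (hZi : Measurable Zi) (hZp : Measurable Zp)
    (hDi : ∀ z z', Measurable (Di z z')) (hDp : ∀ z z', Measurable (Dp z z'))
    (hYm : ∀ d dp, Measurable (Y d dp)) (hYint : ∀ d dp, Integrable (Y d dp) P)
    (hZpos : ∀ z z', 0 < P (ZevM Zi Zp z z'))
    -- Assumption IV: independence and own-instrument monotonicity
    (hIndep : IndepFun (fun ω => (Zi ω, Zp ω))
      (fun ω => (fun z z' => Di z z' ω, fun z z' => Dp z z' ω,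
        fun d dp => Y d dp ω)) P)
    (hIV : ∀ᵐ ω ∂P, (∀ z, Di false z ω ≤ Di true z ω) ∧
      ∀ zi j, Dp zi false ω j ≤ Dp zi true ω j)
    -- Assumption SM: monotonicity in the spillovers
    (hSM : ∀ᵐ ω ∂P, (∀ zi, Di zi false ω ≤ Di zi true ω) ∧
      ∀ z j, Dp false z ω j ≤ Dp true z ω j)
    -- Assumption IRR: irrelevance
    (hIRR : ∀ᵐ ω ∂P, (∀ z, Di true z ω = Di false z ω → Dp true z ω = Dp false z ω) ∧
      ∀ zi, Dp zi true ω = Dp zi false ω → Di zi true ω = Di zi false ω)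
    :
    dEM P Zi Zp (fun z z' ω => ∏ j, b2r (Dp z z' ω j)) true true false true =
      (P {ω | Di true true ω = true ∧ Di false true ω = false ∧
        Dp false true ω ≠ Dp true true ω ∧
        ∀ j, Dp true true ω j = true}).toReal ∧
    dEM P Zi Zp (fun z z' ω => b2r (Di z z' ω) *
        ∏ j, b2r (Dp z z' ω j)) true true false true =
      (P {ω | Di true true ω = true ∧ Di false true ω = false ∧
        ∀ j, Dp true true ω j = true}).toReal := by
  classical
  have hDi' (z z') (b : Bool) : MeasurableSet {ω | Di z z' ω = b} :=
    hDi z z' (measurableSet_singleton b)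
  have hall : MeasurableSet {ω | ∀ j, Dp true true ω j = true} :=
    hDp true true (Set.toFinite {v : Fin m → Bool | ∀ j, v j = true}).measurableSet
  have hprod (z z' : Bool) : Measurable fun ω => ∏ j, b2r (Dp z z' ω j) :=
    (measurable_of_finite fun v : Fin m → Bool => ∏ j, b2r (v j)).comp (hDp z z')
  constructor
  · refine dEM_eq_measureReal (φ := fun z z' t => ∏ j, b2r (t.2.1 z z' j)) hZi hZp hZpos hIndep
      (fun z z' => ?_) (fun z z' => ?_) ?_ ?_
    · exact (measurable_of_finite fun v : Bool → Bool → Fin m → Bool =>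
        ∏ j, b2r (v z z' j)).comp (measurable_fst.comp measurable_snd)
    · exact .of_bound (hprod z z').aestronglyMeasurable 1
        (.of_forall fun ω => norm_prod_b2r_le_one _)
    · exact (hDi' _ _ _).inter ((hDi' _ _ _).inter
        ((measurableSet_eq_fun (hDp _ _) (hDp _ _)).compl.inter hall))
    · filter_upwards [hIV, hSM, hIRR] with ω h1 h2 h3
      have hle := h1.1 true
      have hpeer := h2.2 true
      have hirr := h3.1 true
      simp only [prod_b2r, Set.indicator_apply, Set.mem_ofPred_eq, Pi.one_apply]
      by_cases heq : Dp false true ω = Dp true true ω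
      · simp [heq]
      · have hne : Di true true ω ≠ Di false true ω := fun h => heq (hirr h).symm
        have hD : Di true true ω = true ∧ Di false true ω = false := by
          revert hle hne
          cases Di true true ω <;> cases Di false true ω <;> simp
        have hnot : ¬ ∀ j, Dp false true ω j = true := fun h =>
          heq (funext fun j => (h j).trans (hpeer j (h j)).symm)
        simp [hD, heq, hnot]
  · refine dEM_eq_measureReal (φ := fun z z' t => b2r (t.1 z z') * ∏ j, b2r (t.2.1 z z' j))
      hZi hZp hZpos hIndep (fun z z' => ?_) (fun z z' => ?_) ?_ ?_
    · exact ((measurable_of_finite fun v : Bool → Bool → Bool => b2r (v z z')).comp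
        measurable_fst).mul ((measurable_of_finite fun v : Bool → Bool → Fin m → Bool =>
        ∏ j, b2r (v z z' j)).comp (measurable_fst.comp measurable_snd))
    · refine .of_bound ((measurable_b2r.comp (hDi z z')).mul (hprod z z')).aestronglyMeasurable 1
        (.of_forall fun ω => ?_)
      exact (norm_mul_le _ _).trans
        (mul_le_one₀ (norm_b2r_le_one _) (norm_nonneg _) (norm_prod_b2r_le_one _))
    · exact (hDi' _ _ _).inter ((hDi' _ _ _).inter hall)
    · filter_upwards [hIV, hIRR] with ω h1 h3
      have hle := h1.1 true
      have hirr := h3.1 true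
      simp only [prod_b2r, Set.indicator_apply, Set.mem_ofPred_eq, Pi.one_apply]
      by_cases heq : Di true true ω = Di false true ω
      · simp +contextual [hirr heq, heq]
      · have hD : Di true true ω = true ∧ Di false true ω = false := by
          revert hle heq
          cases Di true true ω <;> cases Di false true ω <;> simp
        simp [hD]

end
end

section
/- First-stage identity isolating never-takers with instrument-responsive peers. Assume Assumptions IV, SM and IRR hold. Then Δ^{11}_{10}E[(1−D_i) D_{(i)}^∧] = P(D_i(1,1) = 0, D_{(i)}(1,0) ≠ D_{(i)}(1,1) = 1). -/
open MeasureTheory ProbabilityTheory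

noncomputable section

variable {Ω : Type*} {m : ℕ}

/-- If `S` is independent of the non-null event `A`, conditioning the indicator of `S` on `A`
has no effect. -/
theorem cexp_indicator_of_indep [MeasurableSpace Ω] {P : Measure Ω} [IsProbabilityMeasure P]
    {A S : Set Ω} (hS : MeasurableSet S) (hA : P A ≠ 0) (h : P (A ∩ S) = P A * P S) :
    cexp P (S.indicator 1) A = P.real S := by
  have hA' : P.real A ≠ 0 := (measureReal_ne_zero_iff).2 hA
  rw [cexp, integral_indicator_one hS, measureReal_restrict_apply hS, Set.inter_comm,
    measureReal_def, h, ENNReal.toReal_mul]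
  exact mul_div_cancel_left₀ _ hA'

theorem one_sub_b2r_mul_prod (a : Bool) (v : Fin m → Bool) :
    (1 - b2r a) * ∏ j, b2r (v j) = if a = false ∧ ∀ j, v j = true then 1 else 0 := by
  have hprod : ∏ j, b2r (v j) = if ∀ j, v j = true then 1 else 0 := by
    simpa [b2r] using Finset.prod_ite_zero (s := Finset.univ) (p := fun j => v j = true)
      (f := fun _ => (1 : ℝ))
  rw [hprod]
  cases a <;> simp [b2r]

theorem measurableSet_fst_eq_and_snd_const (z z' : Bool) :
    MeasurableSet {p : Bool × (Fin m → Bool) | p.1 = z ∧ ∀ j, p.2 j = z'} :=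
  Set.Finite.measurableSet (Set.toFinite _)

/-- The event that the individual is untreated while every peer is treated, under the
instrument pattern `(z, z')`. -/
def untreatedWithTreatedPeers (Di : Bool → Bool → Ω → Bool) (Dp : Bool → Bool → Ω → Fin m → Bool)
    (z z' : Bool) : Set Ω :=
  {ω | Di z z' ω = false ∧ ∀ j, Dp z z' ω j = true}

theorem measurableSet_untreatedWithTreatedPeers [MeasurableSpace Ω]
    {Di : Bool → Bool → Ω → Bool} {Dp : Bool → Bool → Ω → Fin m → Bool}
    (hDi : ∀ z z', Measurable (Di z z')) (hDp : ∀ z z', Measurable (Dp z z')) (z z' : Bool) :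
    MeasurableSet (untreatedWithTreatedPeers Di Dp z z') :=
  ((hDi z z').prodMk (hDp z z')) (measurableSet_fst_eq_and_snd_const false true)

/-- Under randomized instruments, the conditional mean of the untreated-with-treated-peers
indicator is the probability of the corresponding potential-treatment event. -/
theorem cexp_untreatedWithTreatedPeers [MeasurableSpace Ω] {P : Measure Ω}
    [IsProbabilityMeasure P] {Zi : Ω → Bool} {Zp : Ω → Fin m → Bool}
    {Di : Bool → Bool → Ω → Bool} {Dp : Bool → Bool → Ω → Fin m → Bool}
    (hDi : ∀ z z', Measurable (Di z z')) (hDp : ∀ z z', Measurable (Dp z z')) (z z' : Bool)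
    (hpos : 0 < P (ZevM Zi Zp z z'))
    (h : IndepFun (fun ω => (Zi ω, Zp ω)) (fun ω => (Di z z' ω, Dp z z' ω)) P) :
    cexp P (fun ω => (1 - b2r (Di z z' ω)) * ∏ j, b2r (Dp z z' ω j)) (ZevM Zi Zp z z') =
      P.real (untreatedWithTreatedPeers Di Dp z z') := by
  have hX : (fun ω => (1 - b2r (Di z z' ω)) * ∏ j, b2r (Dp z z' ω j)) =
      (untreatedWithTreatedPeers Di Dp z z').indicator 1 := by
    funext ω
    classical
    simp only [one_sub_b2r_mul_prod, Set.indicator_apply, untreatedWithTreatedPeers,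
      Set.mem_ofPred_eq, Pi.one_apply]
  rw [hX]
  exact cexp_indicator_of_indep (measurableSet_untreatedWithTreatedPeers hDi hDp z z') hpos.ne'
    (h.measure_inter_preimage_eq_mul _ _ (measurableSet_fst_eq_and_snd_const z z')
      (measurableSet_fst_eq_and_snd_const false true))

/-- First-stage identity isolating never-takers with instrument-responsive peers. -/
theorem first_stage_never_takers_responsive_peers
    [MeasurableSpace Ω] (P : Measure Ω) [IsProbabilityMeasure P]
    (m : ℕ) (hm : 1 ≤ m)
    (Zi : Ω → Bool) (Zp : Ω → Fin m → Bool)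
    (Di : Bool → Bool → Ω → Bool) (Dp : Bool → Bool → Ω → Fin m → Bool)
    (Y : Bool → (Fin m → Bool) → Ω → ℝ)
    (hZi : Measurable Zi) (hZp : Measurable Zp)
    (hDi : ∀ z z', Measurable (Di z z')) (hDp : ∀ z z', Measurable (Dp z z'))
    (hYm : ∀ d dp, Measurable (Y d dp)) (hYint : ∀ d dp, Integrable (Y d dp) P)
    (hZpos : ∀ z z', 0 < P (ZevM Zi Zp z z'))
    -- Assumption IV: independence and own-instrument monotonicity
    (hIndep : IndepFun (fun ω => (Zi ω, Zp ω))
      (fun ω => (fun z z' => Di z z' ω, fun z z' => Dp z z' ω,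
        fun d dp => Y d dp ω)) P)
    (hIV : ∀ᵐ ω ∂P, (∀ z, Di false z ω ≤ Di true z ω) ∧
      ∀ zi j, Dp zi false ω j ≤ Dp zi true ω j)
    -- Assumption SM: monotonicity in the spillovers
    (hSM : ∀ᵐ ω ∂P, (∀ zi, Di zi false ω ≤ Di zi true ω) ∧
      ∀ z j, Dp false z ω j ≤ Dp true z ω j)
    -- Assumption IRR: irrelevance
    (hIRR : ∀ᵐ ω ∂P, (∀ z, Di true z ω = Di false z ω → Dp true z ω = Dp false z ω) ∧
      ∀ zi, Dp zi true ω = Dp zi false ω → Di zi true ω = Di zi false ω)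
    :
    dEM P Zi Zp (fun z z' ω => (1 - b2r (Di z z' ω)) *
        ∏ j, b2r (Dp z z' ω j)) true true true false =
      (P {ω | Di true true ω = false ∧
        Dp true false ω ≠ Dp true true ω ∧
        ∀ j, Dp true true ω j = true}).toReal := by
  have hpair (z z' : Bool) :
      IndepFun (fun ω => (Zi ω, Zp ω)) (fun ω => (Di z z' ω, Dp z z' ω)) P :=
    hIndep.comp (φ := id) (ψ := fun q : (Bool → Bool → Bool) × (Bool → Bool → Fin m → Bool) ×
      (Bool → (Fin m → Bool) → ℝ) => (q.1 z z', q.2.1 z z')) measurable_id (by fun_prop)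
  rw [dEM, cexp_untreatedWithTreatedPeers hDi hDp _ _ (hZpos _ _) (hpair _ _),
    cexp_untreatedWithTreatedPeers hDi hDp _ _ (hZpos _ _) (hpair _ _)]
  have hle : untreatedWithTreatedPeers Di Dp true false ≤ᵐ[P]
      untreatedWithTreatedPeers Di Dp true true := by
    filter_upwards [hIV, hIRR] with ω hiv hirr
    rintro ⟨hd, hp⟩
    have hp' (j : Fin m) : Dp true true ω j = true := by
      simpa [hp j, Bool.le_iff_imp] using hiv.2 true j
    refine ⟨?_, hp'⟩
    rw [hirr.2 true (funext fun j => by rw [hp j, hp' j]), hd]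
  have hdiff : {ω | Di true true ω = false ∧ Dp true false ω ≠ Dp true true ω ∧
        ∀ j, Dp true true ω j = true} =ᵐ[P]
      (untreatedWithTreatedPeers Di Dp true true \
        untreatedWithTreatedPeers Di Dp true false : Set Ω) := by
    refine Filter.eventuallyEq_set.2 ?_
    filter_upwards [hSM] with ω hsm
    have hmono := hsm.1 true
    simp only [untreatedWithTreatedPeers, Set.mem_ofPred_eq, Set.mem_sdiff]
    constructor
    · rintro ⟨hd, hne, hp⟩
      exact ⟨⟨hd, hp⟩, fun h => hne (funext fun j => by rw [h.2 j, hp j])⟩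
    · rintro ⟨⟨hd, hp⟩, hn⟩
      refine ⟨hd, fun heq => hn ⟨?_, fun j => by rw [heq, hp j]⟩, hp⟩
      simpa [hd, Bool.le_iff_imp] using hmono
  have hS := measurableSet_untreatedWithTreatedPeers hDi hDp true false
  rw [measure_congr hdiff, ← measureReal_def]
  have hsplit := measureReal_inter_add_sdiff (μ := P)
    (s := untreatedWithTreatedPeers Di Dp true true) hS
  have hinter : P.real (untreatedWithTreatedPeers Di Dp true true ∩
      untreatedWithTreatedPeers Di Dp true false) =
      P.real (untreatedWithTreatedPeers Di Dp true false) := by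
    refine measureReal_congr (Filter.eventuallyEq_set.2 ?_)
    filter_upwards [hle] with ω hω
    exact ⟨fun h => h.2, fun h => ⟨hω h, h⟩⟩
  linarith

end
end

section
/- Identification of the always-taker-with-never-taker-peers proportion. Assume Assumptions IV, SM and IRR hold. Then E[D_i D_{(i)}^∨ | Z=(0,1)] = P(D_i(0,0) = 1, D_{(i)}(1,1) = 0); that is, the probability of observing i treated with no treated peers when i's instrument is 0 and all peers' instruments are 1 equals the probability that i is an always-taker and all peers are never-takers. -/
open MeasureTheory ProbabilityTheory

noncomputable section

variable {Ω : Type*} {m : ℕ}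

/-- The indicator product `d · ∏ j, (1 - dp j)` is the indicator that `d` holds and no `dp j` does. -/
theorem b2r_mul_prod_one_sub_b2r {ι : Type*} [Fintype ι] (d : Bool) (dp : ι → Bool)
    [Decidable (d = true ∧ ∀ j, dp j = false)] :
    b2r d * ∏ j, (1 - b2r (dp j)) = if d = true ∧ ∀ j, dp j = false then 1 else 0 := by
  split_ifs with h
  · simp [b2r, h.1, h.2]
  · by_cases hd : d = true
    · obtain ⟨j, hj⟩ : ∃ j, dp j = true := by simpa [hd] using h
      have : ∏ j, (1 - b2r (dp j)) = 0 :=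
        Finset.prod_eq_zero (Finset.mem_univ j) (by simp [b2r, hj])
      simp [this]
    · simp [b2r, hd]

/-- The conditional expectation of the indicator of an event independent of the conditioning
event is its probability. -/
theorem cexp_indicator_of_measure_inter [MeasurableSpace Ω] (P : Measure Ω)
    [IsFiniteMeasure P] {A E : Set Ω} (hE : MeasurableSet E) (hA : 0 < P A)
    (h : P (A ∩ E) = P A * P E) :
    cexp P (E.indicator 1) A = (P E).toReal := by
  have hA' : (P A).toReal ≠ 0 := (ENNReal.toReal_pos hA.ne' (measure_ne_top P A)).ne'
  rw [cexp, integral_indicator_one hE, measureReal_restrict_apply hE, Set.inter_comm,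
    Measure.real, h, ENNReal.toReal_mul, mul_div_cancel_left₀ _ hA']

/-- Identification of the always-taker-with-never-taker-peers proportion. -/
theorem always_taker_never_taker_peers_proportion
    [MeasurableSpace Ω] (P : Measure Ω) [IsProbabilityMeasure P]
    (m : ℕ) (hm : 1 ≤ m)
    (Zi : Ω → Bool) (Zp : Ω → Fin m → Bool)
    (Di : Bool → Bool → Ω → Bool) (Dp : Bool → Bool → Ω → Fin m → Bool)
    (Y : Bool → (Fin m → Bool) → Ω → ℝ)
    (hZi : Measurable Zi) (hZp : Measurable Zp)
    (hDi : ∀ z z', Measurable (Di z z')) (hDp : ∀ z z', Measurable (Dp z z'))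
    (hYm : ∀ d dp, Measurable (Y d dp)) (hYint : ∀ d dp, Integrable (Y d dp) P)
    (hZpos : ∀ z z', 0 < P (ZevM Zi Zp z z'))
    -- Assumption IV: independence and own-instrument monotonicity
    (hIndep : IndepFun (fun ω => (Zi ω, Zp ω))
      (fun ω => (fun z z' => Di z z' ω, fun z z' => Dp z z' ω,
        fun d dp => Y d dp ω)) P)
    (hIV : ∀ᵐ ω ∂P, (∀ z, Di false z ω ≤ Di true z ω) ∧
      ∀ zi j, Dp zi false ω j ≤ Dp zi true ω j)
    -- Assumption SM: monotonicity in the spillovers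
    (hSM : ∀ᵐ ω ∂P, (∀ zi, Di zi false ω ≤ Di zi true ω) ∧
      ∀ z j, Dp false z ω j ≤ Dp true z ω j)
    -- Assumption IRR: irrelevance
    (hIRR : ∀ᵐ ω ∂P, (∀ z, Di true z ω = Di false z ω → Dp true z ω = Dp false z ω) ∧
      ∀ zi, Dp zi true ω = Dp zi false ω → Di zi true ω = Di zi false ω)
    :
    cexp P (fun ω => b2r (Di false true ω) *
        ∏ j, (1 - b2r (Dp false true ω j))) (ZevM Zi Zp false true) =
      (P {ω | Di false false ω = true ∧
        ∀ j, Dp true true ω j = false}).toReal := by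
  set E : Set Ω := {ω | Di false true ω = true ∧ ∀ j, Dp false true ω j = false} with hEdef
  have hE : MeasurableSet E := by
    have := hDi false true
    have := hDp false true
    measurability
  have hfun : (fun ω => b2r (Di false true ω) * ∏ j, (1 - b2r (Dp false true ω j))) =
      E.indicator 1 := by
    classical
    funext ω
    rw [b2r_mul_prod_one_sub_b2r, Set.indicator_apply]
    rfl
  have hinter : P (ZevM Zi Zp false true ∩ E) = P (ZevM Zi Zp false true) * P E :=
    hIndep.measure_inter_preimage_eq_mul
      {p | p.1 = false ∧ ∀ j, p.2 j = true}
      {q | q.1 false true = true ∧ ∀ j, q.2.1 false true j = false}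
      (by measurability) (by measurability)
  rw [hfun, cexp_indicator_of_measure_inter P hE (hZpos false true) hinter]
  congr 1
  refine measure_congr ?_
  filter_upwards [hIV, hSM, hIRR] with ω ⟨hDmono, hpmono⟩ ⟨hDspill, hpspill⟩ ⟨hirrp, hirrD⟩
  refine propext ⟨fun ⟨hd, hp⟩ => ?_, fun ⟨hd, hp⟩ => ?_⟩
  · have hp0 : Dp false true ω = Dp false false ω := by
      funext j
      have := hpmono false j
      rw [hp j] at this ⊢
      exact (Bool.eq_false_of_le_false this).symm
    have hd1 : Di true true ω = true := Bool.eq_true_of_true_le (hd.symm.trans_le (hDmono true))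
    have hp1 := hirrp true (hd1.trans hd.symm)
    exact ⟨(hirrD false hp0).symm.trans hd, fun j => (congrFun hp1 j).trans (hp j)⟩
  · exact ⟨Bool.eq_true_of_true_le (hd.symm.trans_le (hDspill false)),
      fun j => Bool.eq_false_of_le_false ((hpspill true j).trans_eq (hp j))⟩

end
end

section
/- Identification of the never-taker-with-always-taker-peers proportion. Assume Assumptions IV, SM and IRR hold. Then E[(1−D_i) D_{(i)}^∧ | Z=(1,0)] = P(D_i(1,1) = 0, D_{(i)}(0,0) = 1); that is, the probability of observing i untreated with all peers treated when i's instrument is 1 and all peers' instruments are 0 equals the probability that i is a never-taker and all peers are always-takers. -/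
open MeasureTheory ProbabilityTheory

noncomputable section

variable {Ω : Type*} {m : ℕ}

/-- Conditioning an indicator on an event independent of it leaves its probability. -/
theorem cexp_indicator_of_indep_s17 [MeasurableSpace Ω] (P : Measure Ω) [IsProbabilityMeasure P]
    {A B : Set Ω} (hB : MeasurableSet B) (hA0 : 0 < P A) (hAB : P (A ∩ B) = P A * P B) :
    cexp P (B.indicator fun _ => 1) A = (P B).toReal := by
  have hne : (P A).toReal ≠ 0 := (ENNReal.toReal_pos hA0.ne' (measure_ne_top P A)).ne'
  rw [cexp, setIntegral_indicator hB, setIntegral_const, Measure.real, hAB, ENNReal.toReal_mul,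
    smul_eq_mul, mul_one, mul_div_cancel_left₀ _ hne]

/-- The observed product is the indicator of an untreated unit with all peers treated. -/
theorem one_sub_b2r_mul_prod_b2r (D : Ω → Bool) (Q : Ω → Fin m → Bool) :
    (fun ω => (1 - b2r (D ω)) * ∏ j, b2r (Q ω j)) =
      {ω | D ω = false ∧ ∀ j, Q ω j = true}.indicator fun _ => 1 := by
  funext ω
  by_cases hQ : ∀ j, Q ω j = true
  · cases h : D ω <;> simp [Set.indicator, b2r, h, hQ]
  · obtain ⟨j, hj⟩ := not_forall.mp hQ
    rw [Finset.prod_eq_zero (Finset.mem_univ j) (by simp [b2r, hj]), mul_zero,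
      Set.indicator_of_notMem fun h => hQ h.2]

/-- Identification of the never-taker-with-always-taker-peers proportion. -/
theorem never_taker_always_taker_peers_proportion
    [MeasurableSpace Ω] (P : Measure Ω) [IsProbabilityMeasure P]
    (m : ℕ) (hm : 1 ≤ m)
    (Zi : Ω → Bool) (Zp : Ω → Fin m → Bool)
    (Di : Bool → Bool → Ω → Bool) (Dp : Bool → Bool → Ω → Fin m → Bool)
    (Y : Bool → (Fin m → Bool) → Ω → ℝ)
    (hZi : Measurable Zi) (hZp : Measurable Zp)
    (hDi : ∀ z z', Measurable (Di z z')) (hDp : ∀ z z', Measurable (Dp z z'))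
    (hYm : ∀ d dp, Measurable (Y d dp)) (hYint : ∀ d dp, Integrable (Y d dp) P)
    (hZpos : ∀ z z', 0 < P (ZevM Zi Zp z z'))
    -- Assumption IV: independence and own-instrument monotonicity
    (hIndep : IndepFun (fun ω => (Zi ω, Zp ω))
      (fun ω => (fun z z' => Di z z' ω, fun z z' => Dp z z' ω,
        fun d dp => Y d dp ω)) P)
    (hIV : ∀ᵐ ω ∂P, (∀ z, Di false z ω ≤ Di true z ω) ∧
      ∀ zi j, Dp zi false ω j ≤ Dp zi true ω j)
    -- Assumption SM: monotonicity in the spillovers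
    (hSM : ∀ᵐ ω ∂P, (∀ zi, Di zi false ω ≤ Di zi true ω) ∧
      ∀ z j, Dp false z ω j ≤ Dp true z ω j)
    -- Assumption IRR: irrelevance
    (hIRR : ∀ᵐ ω ∂P, (∀ z, Di true z ω = Di false z ω → Dp true z ω = Dp false z ω) ∧
      ∀ zi, Dp zi true ω = Dp zi false ω → Di zi true ω = Di zi false ω)
    :
    cexp P (fun ω => (1 - b2r (Di true false ω)) *
        ∏ j, b2r (Dp true false ω j)) (ZevM Zi Zp true false) =
      (P {ω | Di true true ω = false ∧
        ∀ j, Dp false false ω j = true}).toReal := by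
  have hS : MeasurableSet {p : Bool × (Fin m → Bool) | p.1 = true ∧ ∀ j, p.2 j = false} :=
    Set.Finite.measurableSet (Set.toFinite _)
  have hT : MeasurableSet {p : (Bool → Bool → Bool) × (Bool → Bool → Fin m → Bool) ×
      (Bool → (Fin m → Bool) → ℝ) | p.1 true false = false ∧ ∀ j, p.2.1 true false j = true} := by
    have h1 : MeasurableSet {q : (Bool → Bool → Bool) | q true false = false} :=
      Set.Finite.measurableSet (Set.toFinite _)
    have h2 : MeasurableSet {q : (Bool → Bool → Fin m → Bool) | ∀ j, q true false j = true} :=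
      Set.Finite.measurableSet (Set.toFinite _)
    exact (measurable_fst h1).inter ((measurable_fst.comp measurable_snd) h2)
  have hB : MeasurableSet {ω | Di true false ω = false ∧ ∀ j, Dp true false ω j = true} :=
    (hDi true false (measurableSet_singleton false)).inter
      (hDp true false (Set.Finite.measurableSet (Set.toFinite {q : Fin m → Bool | ∀ j, q j = true})))
  rw [one_sub_b2r_mul_prod_b2r, cexp_indicator_of_indep_s17 P hB (hZpos true false)
    (hIndep.measure_inter_preimage_eq_mul _ _ hS hT)]
  congr 1
  apply measure_congr
  filter_upwards [hIV, hSM, hIRR] with ω ⟨hiv, hiv'⟩ ⟨hsm, hsm'⟩ ⟨hirr, hirr'⟩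
  refine propext ⟨fun ⟨hd, hp⟩ => ⟨?_, fun j => ?_⟩, fun ⟨hd, hp⟩ => ⟨?_, fun j => ?_⟩⟩
  · rw [hirr' true (funext fun j => ?_), hd]
    rw [hp j]
    exact Bool.eq_true_of_true_le ((hp j).ge.trans (hiv' true j))
  · have h0 : Di false false ω = false := Bool.eq_false_of_le_false ((hiv false).trans hd.le)
    rw [← hirr false (hd.trans h0.symm)]
    exact hp j
  · exact Bool.eq_false_of_le_false ((hsm true).trans hd.le)
  · exact Bool.eq_true_of_true_le ((hp j).ge.trans (hsm' false j))

end
end
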